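/- arXiv:1605.05159 — 2 statements merged into one kernel-verified Lean document; each statement's English description precedes it below -/
import Mathlib

section
/- Let M be a finite-dimensional A-module and let p : P → M^∨ be a projective cover of its twisted dual, i.e., P is a finite-dimensional projective A-module, p is a surjective A-linear map, and ker p is superfluous in P (for every submodule U of P, U + ker p = P implies U = P). Then P^∨ is an injective A-module, and the composite ι of the evaluation isomorphism M ≅ (M^∨)^∨ with the dual map p^∨ : (M^∨)^∨ → P^∨ is an injective A-linear map whose image is an essential submodule of P^∨ (every nonzero submodule of P^∨ intersects the image of ι nontrivially). In other words, ι : M → P^∨ is an injective hull of M: the injective hull of a module is the dual of the projective cover of its twisted dual. -/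
namespace TL

variable {K A : Type*} [Field K] [Ring A] [Algebra K A]

/-- A `K`-linear involutive antiautomorphism of `A`. -/
structure AntiAut (K A : Type*) [Field K] [Ring A] [Algebra K A] where
  σ : A →ₗ[K] A
  anti : ∀ a b : A, σ (a * b) = σ b * σ a
  invol : ∀ a : A, σ (σ a) = a

theorem AntiAut.sigma_one (τ : AntiAut K A) : τ.σ 1 = 1 := by
  have h : ∀ b : A, τ.σ 1 * b = b := by
    intro b
    conv_lhs => rw [← τ.invol b]
    rw [← τ.anti (τ.σ b) 1, mul_one, τ.invol]
  simpa using h 1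

section

variable {M : Type*} [AddCommGroup M] [Module K M] [Module A M] [IsScalarTower K A M]

/-- Scalar multiplication by `a : A` as a `K`-linear endomorphism of `M`. -/
def actL (a : A) : M →ₗ[K] M where
  toFun m := a • m
  map_add' := smul_add a
  map_smul' c m := smul_comm a c m

/-- The twisted dual of a left `A`-module `M`: the `K`-linear dual of `M`,
equipped below with the `A`-action `(a • f) m = f (τ.σ a • m)`. -/
def TwistedDual (τ : AntiAut K A) (M : Type*) [AddCommGroup M] [Module K M]
    [Module A M] [IsScalarTower K A M] : Type _ :=
  Module.Dual K M

namespace TwistedDual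

variable (τ : AntiAut K A)

/-- Build an element of the twisted dual from a `K`-linear functional. -/
def of (f : Module.Dual K M) : TwistedDual τ M := f

/-- The underlying `K`-linear functional of an element of the twisted dual. -/
def toDual (f : TwistedDual τ M) : Module.Dual K M := f

instance : FunLike (TwistedDual τ M) M K :=
  inferInstanceAs (FunLike (M →ₗ[K] K) M K)

instance : AddCommGroup (TwistedDual τ M) :=
  inferInstanceAs (AddCommGroup (Module.Dual K M))

instance : Module K (TwistedDual τ M) :=
  inferInstanceAs (Module K (Module.Dual K M))

theorem ext {f g : TwistedDual τ M} (h : ∀ m, f m = g m) : f = g :=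
  DFunLike.ext f g h

theorem map_add (f : TwistedDual τ M) (x y : M) : f (x + y) = f x + f y :=
  (toDual τ f).map_add x y

theorem map_smulK (f : TwistedDual τ M) (c : K) (x : M) : f (c • x) = c • f x :=
  (toDual τ f).map_smul c x

theorem add_apply (f g : TwistedDual τ M) (m : M) : (f + g) m = f m + g m := rfl

theorem zero_apply (m : M) : (0 : TwistedDual τ M) m = 0 := rfl

theorem ksmul_apply (c : K) (f : TwistedDual τ M) (m : M) : (c • f) m = c • f m := rfl

instance : SMul A (TwistedDual τ M) :=
  ⟨fun a f => of τ ((toDual τ f).comp (actL (τ.σ a)))⟩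

theorem smul_apply (a : A) (f : TwistedDual τ M) (m : M) :
    (a • f) m = f (τ.σ a • m) := rfl

instance : MulAction A (TwistedDual τ M) where
  one_smul f := ext τ fun m => by rw [smul_apply, AntiAut.sigma_one, one_smul]
  mul_smul a b f := ext τ fun m => by
    rw [smul_apply, smul_apply, smul_apply, τ.anti, mul_smul]

instance : DistribMulAction A (TwistedDual τ M) where
  smul_zero a := ext τ fun m => rfl
  smul_add a f g := ext τ fun m => rfl

instance : Module A (TwistedDual τ M) where
  add_smul a b f := ext τ fun m => by
    rw [smul_apply, add_apply, smul_apply, smul_apply, τ.σ.map_add, add_smul,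
      map_add τ f]
  zero_smul f := ext τ fun m => by
    rw [smul_apply, zero_apply, τ.σ.map_zero, zero_smul]
    exact (toDual τ f).map_zero

instance : IsScalarTower K A (TwistedDual τ M) :=
  ⟨fun c a f => ext τ fun m => by
    rw [smul_apply, ksmul_apply, smul_apply, τ.σ.map_smul, smul_assoc, map_smulK τ f]⟩

variable {N : Type*} [AddCommGroup N] [Module K N] [Module A N] [IsScalarTower K A N]

/-- The (twisted) dual of an `A`-linear map: `map τ φ f = f ∘ φ`. -/
def map (φ : M →ₗ[A] N) : TwistedDual τ N →ₗ[A] TwistedDual τ M where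
  toFun f := of τ ((toDual τ f).comp (φ.restrictScalars K))
  map_add' f g := ext τ fun m => rfl
  map_smul' a f := ext τ fun m => by
    show f (τ.σ a • φ m) = f (φ (τ.σ a • m))
    rw [φ.map_smul]

theorem map_apply (φ : M →ₗ[A] N) (f : TwistedDual τ N) (m : M) :
    map τ φ f m = f (φ m) := rfl

/-- The canonical evaluation map from `M` into its twisted double dual. -/
def eval (M : Type*) [AddCommGroup M] [Module K M] [Module A M] [IsScalarTower K A M] :
    M →ₗ[A] TwistedDual τ (TwistedDual τ M) where
  toFun x := of τ
    { toFun := fun f : TwistedDual τ M => f x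
      map_add' := fun f g => rfl
      map_smul' := fun c f => rfl }
  map_add' x y := ext τ fun f => map_add τ f x y
  map_smul' a x := ext τ fun f => by
    show f (a • x) = (τ.σ a • f) x
    rw [smul_apply, τ.invol]

theorem eval_apply (x : M) (f : TwistedDual τ M) : eval τ M x f = f x := rfl

end TwistedDual

end

end TL

namespace TL

namespace TwistedDual

section

variable {K A : Type*} [Field K] [Ring A] [Algebra K A] (τ : AntiAut K A)
variable {M : Type*} [AddCommGroup M] [Module K M] [Module A M] [IsScalarTower K A M]
variable {N : Type*} [AddCommGroup N] [Module K N] [Module A N] [IsScalarTower K A N]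

theorem map_surjective_of_injective {φ : M →ₗ[A] N} (hφ : Function.Injective φ) :
    Function.Surjective (map τ φ) := fun f => by
  obtain ⟨g, hg⟩ := LinearMap.dualMap_surjective_of_injective
    (f := φ.restrictScalars K) hφ (toDual τ f)
  exact ⟨of τ g, hg⟩

/-- The twisted dual of a projective module is injective. -/
theorem injective_of_projective [Module.Projective A M] :
    Module.Injective A (TwistedDual τ M) where
  out X Y _ _ _ _ f hf g := by
    let _ : Module K X := Module.compHom X (algebraMap K A)
    let _ : Module K Y := Module.compHom Y (algebraMap K A)
    have : IsScalarTower K A X := IsScalarTower.of_algebraMap_smul fun _ _ => rfl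
    have : IsScalarTower K A Y := IsScalarTower.of_algebraMap_smul fun _ _ => rfl
    obtain ⟨h, hh⟩ := Module.projective_lifting_property (map τ f)
      ((map τ g).comp (eval τ M)) (map_surjective_of_injective τ hf)
    refine ⟨(map τ h).comp (eval τ Y), fun x => ext τ fun q => ?_⟩
    exact DFunLike.congr_fun (LinearMap.congr_fun hh q) x

/-- The functionals in a submodule `U` of the twisted dual, as a `K`-subspace of the dual. -/
def toSubspace (U : Submodule A (TwistedDual τ M)) : Submodule K (Module.Dual K M) where
  carrier := {f | of τ f ∈ U}
  add_mem' ha hb := U.add_mem ha hb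
  zero_mem' := U.zero_mem
  smul_mem' c _ hf := (U.restrictScalars K).smul_mem c hf

/-- The common kernel of the functionals in a submodule of the twisted dual. -/
def commonKer (U : Submodule A (TwistedDual τ M)) : Submodule A M where
  carrier := {m | ∀ f ∈ U, f m = 0}
  add_mem' ha hb f hf := by rw [map_add, ha f hf, hb f hf, add_zero]
  zero_mem' f _ := (toDual τ f).map_zero
  smul_mem' a m hm f hf := by
    have := hm (τ.σ a • f) (U.smul_mem _ hf)
    rwa [smul_apply, τ.invol] at this

theorem mem_of_forall_commonKer [FiniteDimensional K M] {U : Submodule A (TwistedDual τ M)}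
    {f : TwistedDual τ M} (hf : ∀ m ∈ commonKer τ U, f m = 0) : f ∈ U := by
  have h : toDual τ f ∈ (toSubspace τ U).dualCoannihilator.dualAnnihilator := by
    rw [Submodule.mem_dualAnnihilator]
    intro m hm
    exact hf m fun g hg => (Submodule.mem_dualCoannihilator m).1 hm (toDual τ g) hg
  rw [Subspace.dualCoannihilator_dualAnnihilator_eq] at h
  exact h

theorem mem_range_map_comp_eval [FiniteDimensional K N] {φ : M →ₗ[A] TwistedDual τ N}
    {f : TwistedDual τ M} (hf : ∀ m ∈ LinearMap.ker φ, f m = 0) :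
    f ∈ LinearMap.range ((map τ φ).comp (eval τ N)) := by
  let ψ : M →ₗ[K] Module.Dual K N := φ.restrictScalars K
  have h : toDual τ f ∈ LinearMap.range ψ.dualMap := by
    rw [LinearMap.range_dualMap_eq_dualAnnihilator_ker, Submodule.mem_dualAnnihilator]
    exact fun m hm => hf m hm
  obtain ⟨g, hg⟩ := h
  obtain ⟨n, rfl⟩ := (Module.evalEquiv K N).surjective g
  exact ⟨n, hg⟩

theorem map_comp_eval_injective {φ : M →ₗ[A] TwistedDual τ N}
    (hφ : Function.Surjective φ) :
    Function.Injective ((map τ φ).comp (eval τ N)) := by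
  refine (injective_iff_map_eq_zero _).2 fun n hn => ?_
  refine (Module.forall_dual_apply_eq_zero_iff K n).1 fun f => ?_
  obtain ⟨m, hm⟩ := hφ (of τ f)
  have h : φ m n = 0 := DFunLike.congr_fun hn m
  rw [hm] at h
  exact h

theorem exists_ne_zero_of_ne_top {W : Submodule A M} (hW : W ≠ ⊤) :
    ∃ f : TwistedDual τ M, f ≠ 0 ∧ ∀ m ∈ W, f m = 0 := by
  have hlt : W.restrictScalars K < ⊤ :=
    lt_top_iff_ne_top.2 fun h => hW ((Submodule.restrictScalars_eq_top_iff K A M).1 h)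
  obtain ⟨f, hf, hle⟩ := Submodule.exists_le_ker_of_lt_top _ hlt
  exact ⟨of τ f, hf, fun m hm => hle hm⟩

end

end TwistedDual

/-- The injective hull of a module is the dual of the projective cover
of its twisted dual: if `p : P → M^∨` is a projective cover (P projective, p surjective
with superfluous kernel), then `P^∨` is injective and the composite
`ι : M → (M^∨)^∨ → P^∨` of the evaluation isomorphism with `p^∨` is injective with
essential image, i.e. `ι : M → P^∨` is an injective hull of `M`. -/
theorem injective_hull_eq_dual_of_projective_cover
    {K A : Type*} [Field K] [Ring A] [Algebra K A] [FiniteDimensional K A]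
    (τ : AntiAut K A)
    {M : Type*} [AddCommGroup M] [Module K M] [Module A M] [IsScalarTower K A M]
    [FiniteDimensional K M]
    {P : Type*} [AddCommGroup P] [Module K P] [Module A P] [IsScalarTower K A P]
    [FiniteDimensional K P]
    (hproj : Module.Projective A P)
    (p : P →ₗ[A] TwistedDual τ M)
    (hsurj : Function.Surjective p)
    (hsuperfluous : ∀ U : Submodule A P, U ⊔ LinearMap.ker p = ⊤ → U = ⊤) :
    Module.Injective A (TwistedDual τ P) ∧
      Function.Injective ((TwistedDual.map τ p).comp (TwistedDual.eval τ M)) ∧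
      ∀ U : Submodule A (TwistedDual τ P), U ≠ ⊥ →
        U ⊓ LinearMap.range ((TwistedDual.map τ p).comp (TwistedDual.eval τ M)) ≠ ⊥ := by
  refine ⟨TwistedDual.injective_of_projective τ,
    TwistedDual.map_comp_eval_injective τ hsurj, fun U hU => ?_⟩
  have hW : TwistedDual.commonKer τ U ⊔ LinearMap.ker p ≠ ⊤ := fun h =>
    hU <| (Submodule.eq_bot_iff U).2 fun f hf => TwistedDual.ext τ fun m =>
      (hsuperfluous _ h ▸ Submodule.mem_top : m ∈ TwistedDual.commonKer τ U) f hf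
  obtain ⟨f, hf0, hf⟩ := TwistedDual.exists_ne_zero_of_ne_top τ hW
  exact (Submodule.ne_bot_iff _).2 ⟨f, ⟨
    TwistedDual.mem_of_forall_commonKer τ fun m hm => hf m (Submodule.mem_sup_left hm),
    TwistedDual.mem_range_map_comp_eval τ fun m hm => hf m (Submodule.mem_sup_right hm)⟩, hf0⟩

end TL
end

section
/- Let 0 → L →^f M →^g N → 0 be a short exact sequence of finite-dimensional A-modules in which L and N are indecomposable and every A-linear map L → N is zero (Hom_A(L, N) = 0). Then M is decomposable (i.e., M is the internal direct sum of two nonzero submodules) if and only if the sequence splits; equivalently, M is indecomposable if and only if the sequence does not split. -/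
section

variable {A L M N : Type*} [Ring A] [AddCommGroup L] [Module A L] [AddCommGroup M] [Module A M]
  [AddCommGroup N] [Module A N]

/-- If `ker g` has a complement and `g` is surjective, then `g` has a section. -/
theorem LinearMap.exists_comp_eq_id_of_isCompl_ker {g : M →ₗ[A] N} (hg : Function.Surjective g)
    {V : Submodule A M} (h : IsCompl (LinearMap.ker g) V) :
    ∃ s : N →ₗ[A] M, g.comp s = LinearMap.id := by
  have hinj : Function.Injective (g.domRestrict V) := by
    rw [← LinearMap.ker_eq_bot, LinearMap.ker_eq_bot']
    intro v hv
    exact Subtype.ext (Submodule.disjoint_def.mp h.disjoint _ hv v.2)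
  have hsurj : Function.Surjective (g.domRestrict V) := by
    intro n
    obtain ⟨m, rfl⟩ := hg n
    obtain ⟨k, v, hk, hv, rfl⟩ := Submodule.codisjoint_iff_exists_add_eq.mp h.codisjoint m
    refine ⟨⟨v, hv⟩, ?_⟩
    rw [LinearMap.domRestrict_apply, map_add, LinearMap.mem_ker.mp hk, zero_add]
  let e := LinearEquiv.ofBijective (g.domRestrict V) ⟨hinj, hsurj⟩
  exact ⟨V.subtype.comp e.symm.toLinearMap, LinearMap.ext fun n => e.apply_symm_apply n⟩

/-- If `Hom(L, N) = 0`, projections along a decomposition of `M` preserve `ker g`. -/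
theorem IsCompl.map_eq_zero_of_map_add_eq_zero {f : L →ₗ[A] M} {g : M →ₗ[A] N}
    (hfg : LinearMap.ker g = LinearMap.range f) (hHom : ∀ φ : L →ₗ[A] N, φ = 0)
    {U V : Submodule A M} (h : IsCompl U V) {u v : M} (hu : u ∈ U) (hv : v ∈ V)
    (huv : g (u + v) = 0) : g u = 0 := by
  obtain ⟨x, hx⟩ : u + v ∈ LinearMap.range f := hfg ▸ LinearMap.mem_ker.mpr huv
  have hp : U.projection V h (u + v) = u := by
    rw [map_add, Submodule.projection_apply_of_mem_left h hu,
      (Submodule.projection_apply_eq_zero_iff h).mpr hv, add_zero]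
  have hzero := LinearMap.congr_fun (hHom (g.comp ((U.projection V h).comp f))) x
  simpa [hx, hp] using hzero

/-- A decomposition of `M` induces one of the submodule `L` when `Hom(L, N) = 0`. -/
theorem IsCompl.comap_of_hom_eq_zero {f : L →ₗ[A] M} {g : M →ₗ[A] N}
    (hf : Function.Injective f) (hfg : LinearMap.ker g = LinearMap.range f)
    (hHom : ∀ φ : L →ₗ[A] N, φ = 0) {U V : Submodule A M} (h : IsCompl U V) :
    IsCompl (U.comap f) (V.comap f) := by
  constructor
  · rw [Submodule.disjoint_def]
    intro x hxU hxV
    exact hf (by rw [Submodule.disjoint_def.mp h.disjoint (f x) hxU hxV, map_zero])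
  · rw [Submodule.codisjoint_iff_exists_add_eq]
    intro x
    obtain ⟨u, v, hu, hv, huv⟩ := Submodule.codisjoint_iff_exists_add_eq.mp h.codisjoint (f x)
    have hgx : g (u + v) = 0 := by
      rw [huv, ← LinearMap.mem_ker, hfg]
      exact ⟨x, rfl⟩
    have hgu := h.map_eq_zero_of_map_add_eq_zero hfg hHom hu hv hgx
    have hgv := h.symm.map_eq_zero_of_map_add_eq_zero hfg hHom hv hu (add_comm u v ▸ hgx)
    obtain ⟨a, rfl⟩ : u ∈ LinearMap.range f := hfg ▸ LinearMap.mem_ker.mpr hgu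
    obtain ⟨b, rfl⟩ : v ∈ LinearMap.range f := hfg ▸ LinearMap.mem_ker.mpr hgv
    exact ⟨a, b, hu, hv, hf (by rw [map_add, huv])⟩

/-- A decomposition of `M` induces one of the quotient `N` when `Hom(L, N) = 0`. -/
theorem IsCompl.map_of_hom_eq_zero {f : L →ₗ[A] M} {g : M →ₗ[A] N}
    (hfg : LinearMap.ker g = LinearMap.range f) (hg : Function.Surjective g)
    (hHom : ∀ φ : L →ₗ[A] N, φ = 0) {U V : Submodule A M} (h : IsCompl U V) :
    IsCompl (U.map g) (V.map g) := by
  constructor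
  · rw [Submodule.disjoint_def]
    rintro _ ⟨u, hu, rfl⟩ ⟨v, hv, hvu⟩
    refine h.map_eq_zero_of_map_add_eq_zero hfg hHom hu (V.neg_mem hv) ?_
    rw [map_add, map_neg, hvu, add_neg_cancel]
  · rw [codisjoint_iff, ← Submodule.map_sup, h.sup_eq_top, Submodule.map_top,
      LinearMap.range_eq_top.mpr hg]

/-- If a summand `V` of `M` meets the image of `L` trivially and `N` is indecomposable, then `V` is
a complement of `ker g`. -/
theorem IsCompl.isCompl_ker_of_comap_eq_bot {f : L →ₗ[A] M} {g : M →ₗ[A] N}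
    (hfg : LinearMap.ker g = LinearMap.range f) (hg : Function.Surjective g)
    (hNind : ∀ U V : Submodule A N, IsCompl U V → U = ⊥ ∨ V = ⊥)
    (hHom : ∀ φ : L →ₗ[A] N, φ = 0) {U V : Submodule A M} (h : IsCompl U V) (hV : V ≠ ⊥)
    (hVL : V.comap f = ⊥) : IsCompl (LinearMap.ker g) V := by
  have hdisj : Disjoint (LinearMap.ker g) V := by
    rw [Submodule.disjoint_def, hfg]
    rintro _ ⟨x, rfl⟩ hx
    rw [(Submodule.eq_bot_iff _).mp hVL x hx, map_zero]
  have hU : U ≤ LinearMap.ker g := by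
    rcases hNind _ _ (h.map_of_hom_eq_zero hfg hg hHom) with hgU | hgV
    · exact LinearMap.le_ker_iff_map.mpr hgU
    · exact absurd (hdisj.eq_bot_of_ge (LinearMap.le_ker_iff_map.mpr hgV)) hV
  exact ⟨hdisj, h.codisjoint.mono_left hU⟩

end


/-- Let `0 → L → M → N → 0` be a short exact sequence of
finite-dimensional `A`-modules with `L` and `N` indecomposable and `Hom_A(L, N) = 0`.
Then `M` is decomposable (an internal direct sum of two nonzero submodules) if and
only if the sequence splits. -/
theorem decomposable_iff_splits
    {K A : Type*} [Field K] [Ring A] [Algebra K A] [FiniteDimensional K A]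
    {L M N : Type*}
    [AddCommGroup L] [Module K L] [Module A L] [IsScalarTower K A L] [FiniteDimensional K L]
    [AddCommGroup M] [Module K M] [Module A M] [IsScalarTower K A M] [FiniteDimensional K M]
    [AddCommGroup N] [Module K N] [Module A N] [IsScalarTower K A N] [FiniteDimensional K N]
    (f : L →ₗ[A] M) (g : M →ₗ[A] N)
    (hf : Function.Injective f) (hfg : LinearMap.ker g = LinearMap.range f)
    (hg : Function.Surjective g)
    (hL : Nontrivial L)
    (hLind : ∀ U V : Submodule A L, IsCompl U V → U = ⊥ ∨ V = ⊥)
    (hN : Nontrivial N)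
    (hNind : ∀ U V : Submodule A N, IsCompl U V → U = ⊥ ∨ V = ⊥)
    (hHom : ∀ φ : L →ₗ[A] N, φ = 0) :
    (∃ U V : Submodule A M, IsCompl U V ∧ U ≠ ⊥ ∧ V ≠ ⊥) ↔
      ∃ s : N →ₗ[A] M, g.comp s = LinearMap.id := by
  constructor
  · rintro ⟨U, V, h, hU, hV⟩
    rcases hLind _ _ (h.comap_of_hom_eq_zero hf hfg hHom) with hUL | hVL
    · exact LinearMap.exists_comp_eq_id_of_isCompl_ker hg
        (h.symm.isCompl_ker_of_comap_eq_bot hfg hg hNind hHom hU hUL)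
    · exact LinearMap.exists_comp_eq_id_of_isCompl_ker hg
        (h.isCompl_ker_of_comap_eq_bot hfg hg hNind hHom hV hVL)
  · rintro ⟨s, hs⟩
    have hgs : ∀ n, g (s n) = n := LinearMap.congr_fun hs
    refine ⟨LinearMap.ker g, LinearMap.range s, ⟨?_, ?_⟩, ?_, ?_⟩
    · rw [Submodule.disjoint_def]
      rintro _ hx ⟨n, rfl⟩
      rw [LinearMap.mem_ker, hgs] at hx
      rw [hx, map_zero]
    · rw [Submodule.codisjoint_iff_exists_add_eq]
      intro m
      refine ⟨m - s (g m), s (g m), ?_, ⟨g m, rfl⟩, sub_add_cancel _ _⟩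
      rw [LinearMap.mem_ker, map_sub, hgs, sub_self]
    · rw [hfg, Ne, LinearMap.range_eq_bot]
      rintro rfl
      obtain ⟨x, hx⟩ := exists_ne (0 : L)
      exact hx (hf rfl)
    · rw [Ne, LinearMap.range_eq_bot]
      rintro rfl
      obtain ⟨n, hn⟩ := exists_ne (0 : N)
      exact hn ((hgs n).symm.trans (map_zero g))
end
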